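/- Let Δ ⊂ ℝ² be a 2-dimensional lattice polytope which is maximal and nonhyperelliptic. Then the number of lattice points on the boundary of Δ is at most 9 more than the number of lattice points on the boundary of Δ^{(1)}, i.e., r ≤ r^{(1)} + 9. -/

import Mathlib

noncomputable section

/-- The embedding of the integer lattice `ℤ²` into the plane `ℝ²`. -/
def toR2 (p : ℤ × ℤ) : ℝ × ℝ := ((p.1 : ℝ), (p.2 : ℝ))

/-- A lattice polytope in `ℝ²`: the convex hull of a finite set of lattice points. -/
def IsLatticePolytope (Δ : Set (ℝ × ℝ)) : Prop :=
  ∃ S : Finset (ℤ × ℤ), Δ = convexHull ℝ (toR2 '' (S : Set (ℤ × ℤ)))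

/-- The lattice points of `Δ`. -/
def latticePts (Δ : Set (ℝ × ℝ)) : Set (ℤ × ℤ) := {p | toR2 p ∈ Δ}

/-- The interior lattice points of `Δ`. -/
def intPts (Δ : Set (ℝ × ℝ)) : Set (ℤ × ℤ) := {p | toR2 p ∈ interior Δ}

/-- The boundary lattice points of `Δ`. -/
def bdPts (Δ : Set (ℝ × ℝ)) : Set (ℤ × ℤ) := {p | toR2 p ∈ frontier Δ}

/-- `Δ⁽¹⁾`: the convex hull of the interior lattice points of `Δ`. -/
def interiorHull (Δ : Set (ℝ × ℝ)) : Set (ℝ × ℝ) := convexHull ℝ (toR2 '' intPts Δ)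

/-- `Δ` is maximal: any lattice polytope strictly containing `Δ` has a different set of
interior lattice points. -/
def IsMaximalPolytope (Δ : Set (ℝ × ℝ)) : Prop :=
  ∀ Δ' : Set (ℝ × ℝ), IsLatticePolytope Δ' → Δ ⊂ Δ' → intPts Δ' ≠ intPts Δ

/-- `Δ` is hyperelliptic: its interior lattice points are collinear. -/
def IsHyperelliptic (Δ : Set (ℝ × ℝ)) : Prop := Collinear ℝ (toR2 '' intPts Δ)

/-- A facet (edge) of `Δ`: a one-dimensional exposed face. -/
def IsFacet (Δ τ : Set (ℝ × ℝ)) : Prop :=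
  IsExposed ℝ Δ τ ∧ Collinear ℝ τ ∧ ¬ τ.Subsingleton

/-- `v` is a column vector of `Δ`: `v ≠ 0` and there is a facet `τ` (the base facet)
such that `v + ((Δ ∖ τ) ∩ ℤ²) ⊆ Δ`. -/
def IsColumnVector (Δ : Set (ℝ × ℝ)) (v : ℤ × ℤ) : Prop :=
  v ≠ 0 ∧ ∃ τ : Set (ℝ × ℝ), IsFacet Δ τ ∧
    ∀ p : ℤ × ℤ, toR2 p ∈ Δ \ τ → toR2 (p + v) ∈ Δ

/-- `c(Δ)`: the number of column vectors of `Δ`. -/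
def colCount (Δ : Set (ℝ × ℝ)) : ℕ := {v : ℤ × ℤ | IsColumnVector Δ v}.ncard

/-- The standard integral bilinear form on `ℤ²`. -/
def dot (u p : ℤ × ℤ) : ℤ := u.1 * p.1 + u.2 * p.2

/-- The determinant of two lattice vectors. -/
def cross (u v : ℤ × ℤ) : ℤ := u.1 * v.2 - u.2 * v.1

/-- A complete unimodular fan in `ℤ²`, given by its finite set `W` of ray generators together
with the counterclockwise successor `σ` and predecessor `π` of every ray. -/
structure IsUnimodularFan (W : Finset (ℤ × ℤ)) (σ π : ℤ × ℤ → ℤ × ℤ) : Prop where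
  next_mem : ∀ u ∈ W, σ u ∈ W
  prev_mem : ∀ u ∈ W, π u ∈ W
  prev_next : ∀ u ∈ W, π (σ u) = u
  next_prev : ∀ u ∈ W, σ (π u) = u
  cross_next : ∀ u ∈ W, cross u (σ u) = 1
  cone_empty : ∀ u ∈ W, ∀ x ∈ W, 0 < cross u x → 0 < cross x (σ u) → False

lemma cross_same (u : ℤ × ℤ) : cross u u = 0 := by simp only [cross]; ring

lemma cross_swap (u v : ℤ × ℤ) : cross v u = -cross u v := by simp only [cross]; ring

/-- Two lattice vectors with the same coordinates in a unimodular basis are equal. -/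
lemma eq_of_cross_eq {e f x y : ℤ × ℤ} (h : cross e f = 1) (h₁ : cross e x = cross e y)
    (h₂ : cross x f = cross y f) : x = y := by
  simp only [cross] at *
  ext
  · linear_combination (x.1 - y.1) * (-h) + e.1 * h₂ + f.1 * h₁
  · linear_combination (x.2 - y.2) * (-h) + e.2 * h₂ + f.2 * h₁

namespace IsUnimodularFan

variable {W : Finset (ℤ × ℤ)} {σ π : ℤ × ℤ → ℤ × ℤ}

lemma cross_prev (h : IsUnimodularFan W σ π) {u : ℤ × ℤ} (hu : u ∈ W) : cross (π u) u = 1 := by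
  have := h.cross_next _ (h.prev_mem u hu)
  rwa [h.next_prev u hu] at this

lemma cone_empty_prev (h : IsUnimodularFan W σ π) {u x : ℤ × ℤ} (hu : u ∈ W) (hx : x ∈ W)
    (h₁ : 0 < cross (π u) x) (h₂ : 0 < cross x u) : False := by
  refine h.cone_empty _ (h.prev_mem u hu) x hx h₁ ?_
  rwa [h.next_prev u hu]

/-- The relation `π w + σ w = a w`, where `a = cross (π w) (σ w)`, tested against a vector. -/
lemma cross_add_cross (h : IsUnimodularFan W σ π) {w : ℤ × ℤ} (hw : w ∈ W) (e : ℤ × ℤ) :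
    cross e (π w) + cross e (σ w) = cross (π w) (σ w) * cross e w := by
  have h₁ := h.cross_prev hw
  have h₂ := h.cross_next w hw
  simp only [cross] at *
  linear_combination (-(e.1 * (σ w).2 - e.2 * (σ w).1)) * h₁ - (e.1 * (π w).2 - e.2 * (π w).1) * h₂

lemma dot_add_dot (h : IsUnimodularFan W σ π) {w : ℤ × ℤ} (hw : w ∈ W) (y : ℤ × ℤ) :
    dot (π w) y + dot (σ w) y = cross (π w) (σ w) * dot w y := by
  have := h.cross_add_cross hw (-y.2, y.1)
  simp only [cross, dot] at *
  linarith

/-- A ray on the line through `e` is `e` or `-e`. -/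
lemma eq_or_eq_neg (h : IsUnimodularFan W σ π) {e x : ℤ × ℤ} (he : e ∈ W) (hx : x ∈ W)
    (h0 : cross e x = 0) : x = e ∨ x = -e := by
  have h₁ := h.cross_next e he
  have h₂ := h.cross_next x hx
  have hu : cross x (σ e) * cross e (σ x) = 1 := by
    simp only [cross] at *
    linear_combination (x.1 * (σ x).2 - x.2 * (σ x).1) * h₁ + h₂ -
      ((σ e).1 * (σ x).2 - (σ e).2 * (σ x).1) * h0
  rcases Int.isUnit_iff.1 (IsUnit.of_mul_eq_one _ hu) with hc | hc
  · left
    refine eq_of_cross_eq h₁ (by rw [h0, cross_same]) (by rw [hc, h₁])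
  · right
    refine eq_of_cross_eq h₁ ?_ ?_
    · rw [h0]; simp only [cross, Prod.fst_neg, Prod.snd_neg]; ring
    · rw [hc]; simp only [cross, Prod.fst_neg, Prod.snd_neg] at *; linarith

/-- Vectors of the same absolute height `≥ 2` over the line through a ray do not span a
unimodular cone. -/
lemma abs_lt_of_le (h : IsUnimodularFan W σ π) {e w s : ℤ × ℤ} (he : e ∈ W)
    (hws : cross w s = 1 ∨ cross s w = 1) (hw : 2 ≤ |cross e w|) (hs : |cross e s| ≤ |cross e w|) :
    |cross e s| < |cross e w| := by
  refine lt_of_le_of_ne hs fun heq ↦ ?_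
  have hf := h.cross_next e he
  have key : cross w s = cross w (σ e) * cross e s - cross s (σ e) * cross e w := by
    simp only [cross] at *
    linear_combination (-(w.1 * s.2 - w.2 * s.1)) * hf
  have hdvd : cross e w ∣ cross w s := by
    rw [key]
    exact dvd_sub (Dvd.dvd.mul_left ((abs_dvd_abs _ _).1 (by rw [heq])) _) (Dvd.intro_left _ rfl)
  have : cross e w ∣ 1 := by
    rcases hws with h1 | h1
    · rwa [h1] at hdvd
    · rw [cross_swap s w, h1] at hdvd
      simpa using hdvd
  have := Int.le_of_dvd one_pos ((abs_dvd _ _).2 this)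
  omega

/-- If some ray has height at least `2` over the ray `e`, then a ray of maximal height has
self-intersection `0` or `1`. -/
lemma cross_eq_zero_or_one (h : IsUnimodularFan W σ π) {e w : ℤ × ℤ} (he : e ∈ W) (hw : w ∈ W)
    (h2 : 2 ≤ |cross e w|) (hmax : ∀ x ∈ W, |cross e x| ≤ |cross e w|) :
    cross (π w) (σ w) = 0 ∨ cross (π w) (σ w) = 1 := by
  have hp := h.abs_lt_of_le he (Or.inr (h.cross_prev hw)) h2 (hmax _ (h.prev_mem w hw))
  have hs := h.abs_lt_of_le he (Or.inl (h.cross_next w hw)) h2 (hmax _ (h.next_mem w hw))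
  have hsum := h.cross_add_cross hw e
  rw [abs_lt] at hp hs
  set a := cross (π w) (σ w)
  rcases le_or_gt 0 (cross e w) with hq | hq
  · rw [abs_of_nonneg hq] at *
    have hpn : 0 ≤ cross e (π w) := by
      by_contra hneg
      exact h.cone_empty_prev hw he (by rw [cross_swap]; omega) (by omega)
    have h1 : -1 < a := by
      by_contra hle
      nlinarith
    have h2 : a < 2 := by
      by_contra hle
      nlinarith
    omega
  · rw [abs_of_neg hq] at *
    have hpn : cross e (σ w) ≤ 0 := by
      by_contra hneg
      exact h.cone_empty _ hw _ he (by rw [cross_swap]; omega) (by omega)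
    have h1 : -1 < a := by
      by_contra hle
      nlinarith
    have h2 : a < 2 := by
      by_contra hle
      nlinarith
    omega

lemma cross_neg_left (x y : ℤ × ℤ) : cross (-x) y = -cross x y := by
  simp only [cross, Prod.fst_neg, Prod.snd_neg]; ring

/-- If all heights over the line through the opposite rays `e` and `-e` are at most one and no
ray is contractible, then `σ e` is the only ray of height one. -/
lemma eq_next_of_cross_eq_one (h : IsUnimodularFan W σ π) {e x : ℤ × ℤ} (he : e ∈ W)
    (hne : -e ∈ W) (hle : ∀ x ∈ W, cross e x ≤ 1) (hno : ∀ w ∈ W, cross (π w) (σ w) ≠ 1)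
    (hx : x ∈ W) (hx1 : cross e x = 1) : x = σ e := by
  have hf := h.cross_next e he
  have hfW := h.next_mem e he
  have hg := h.cross_next _ hfW
  have hgW := h.next_mem _ hfW
  have hsum := h.cross_add_cross hfW e
  rw [h.prev_next e he, cross_same, zero_add, hf, mul_one] at hsum
  have hno' := hno _ hfW
  rw [h.prev_next e he] at hno'
  have h0 : 0 ≤ cross e (σ (σ e)) := by
    by_contra hlt
    exact h.cone_empty _ hfW _ hne (by rw [cross_swap, cross_neg_left]; omega)
      (by rw [cross_neg_left]; omega)
  have h1 := hle _ hgW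
  have hσ : σ (σ e) = -e := by
    rcases h.eq_or_eq_neg he hgW (by omega) with heq | heq
    · rw [heq, cross_swap] at hg
      omega
    · exact heq
  refine eq_of_cross_eq hf (by rw [hx1, hf]) ?_
  rw [cross_same]
  rcases lt_trichotomy (cross x (σ e)) 0 with hk | hk | hk
  · refine (h.cone_empty _ hfW x hx (by rw [cross_swap]; omega) ?_).elim
    rw [hσ, cross_swap, cross_neg_left]
    omega
  · exact hk
  · exact (h.cone_empty _ he x hx (by omega) hk).elim

/-- A fan containing two opposite rays and at least five rays has a contractible ray. -/
lemma exists_cross_eq_one_of_neg_mem (h : IsUnimodularFan W σ π) (hcard : 5 ≤ W.card)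
    {e : ℤ × ℤ} (he : e ∈ W) (hne : -e ∈ W) : ∃ w ∈ W, cross (π w) (σ w) = 1 := by
  obtain ⟨w, hw, hmax⟩ := W.exists_max_image (fun x ↦ |cross e x|) ⟨e, he⟩
  by_cases h2 : 2 ≤ |cross e w|
  · refine ⟨w, hw, (h.cross_eq_zero_or_one he hw h2 hmax).resolve_left fun h0 ↦ ?_⟩
    have hsum := h.cross_add_cross hw e
    rw [h0, zero_mul] at hsum
    have hs1 := h.cross_next w hw
    have hs0 : cross e (σ w) = 0 := by
      rcases lt_or_ge 0 (cross e w) with hq | hq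
      · have h1 : 0 ≤ cross e (π w) := by
          by_contra hlt
          exact h.cone_empty_prev hw he (by rw [cross_swap]; omega) hq
        have h2 : 0 ≤ cross e (σ w) := by
          by_contra hlt
          exact h.cone_empty _ hw _ hne (by rw [cross_swap, cross_neg_left]; omega)
            (by rw [cross_neg_left]; omega)
        omega
      · have hq : cross e w < 0 := lt_of_le_of_ne hq (by intro h; simp [h] at h2)
        have h1 : cross e (π w) ≤ 0 := by
          by_contra hlt
          exact h.cone_empty_prev hw hne (by rw [cross_swap, cross_neg_left]; omega)
            (by rw [cross_neg_left]; omega)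
        have h2 : cross e (σ w) ≤ 0 := by
          by_contra hlt
          exact h.cone_empty _ hw _ he (by rw [cross_swap]; omega) (by omega)
        omega
    rcases h.eq_or_eq_neg he (h.next_mem w hw) hs0 with heq | heq
    · rw [heq, cross_swap] at hs1
      rw [show cross e w = -1 by omega] at h2
      norm_num at h2
    · rw [heq, cross_swap, cross_neg_left] at hs1
      rw [show cross e w = 1 by omega] at h2
      norm_num at h2
  · by_contra! hno
    have hle (x) (hx : x ∈ W) : -1 ≤ cross e x ∧ cross e x ≤ 1 :=
      abs_le.1 ((hmax x hx).trans (by omega))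
    have hsub : W ⊆ {e, -e, σ e, σ (-e)} := by
      intro x hx
      simp only [Finset.mem_insert, Finset.mem_singleton]
      obtain ⟨h1, h2⟩ := hle x hx
      rcases (by omega : cross e x = -1 ∨ cross e x = 0 ∨ cross e x = 1) with hc | hc | hc
      · exact Or.inr <| Or.inr <| Or.inr <| h.eq_next_of_cross_eq_one hne (by rwa [neg_neg])
          (fun y hy ↦ by rw [cross_neg_left]; linarith [(hle y hy).1]) hno hx
          (by rw [cross_neg_left]; omega)
      · rcases h.eq_or_eq_neg he hx hc with heq | heq <;> simp [heq]
      · exact Or.inr <| Or.inr <| Or.inl <|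
          h.eq_next_of_cross_eq_one he hne (fun y hy ↦ (hle y hy).2) hno hx hc
    have := (Finset.card_le_card hsub).trans Finset.card_le_four
    omega

/-- A fan with at least five rays has a contractible ray. -/
lemma exists_cross_eq_one (h : IsUnimodularFan W σ π) (hcard : 5 ≤ W.card) :
    ∃ w ∈ W, cross (π w) (σ w) = 1 := by
  obtain ⟨e, he⟩ : W.Nonempty := Finset.card_pos.1 (by omega)
  by_cases hne : -e ∈ W
  · exact h.exists_cross_eq_one_of_neg_mem hcard he hne
  obtain ⟨w, hw, hmax⟩ := W.exists_max_image (fun x ↦ |cross e x|) ⟨e, he⟩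
  by_cases h2 : 2 ≤ |cross e w|
  · rcases h.cross_eq_zero_or_one he hw h2 hmax with h0 | h1
    · refine h.exists_cross_eq_one_of_neg_mem hcard (h.prev_mem w hw) ?_
      convert h.next_mem w hw using 1
      refine eq_of_cross_eq (h.cross_prev hw) ?_ ?_
      · rw [h0, cross_swap, cross_neg_left, cross_same]; rfl
      · rw [cross_neg_left, h.cross_prev hw, cross_swap, h.cross_next w hw]
    · exact ⟨w, hw, h1⟩
  by_contra! hno
  have hle (x) (hx : x ∈ W) : -1 ≤ cross e x ∧ cross e x ≤ 1 :=
    abs_le.1 ((hmax x hx).trans (by omega))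
  have hzero (x) (hx : x ∈ W) (hc : cross e x = 0) : x = e :=
    (h.eq_or_eq_neg he hx hc).resolve_right fun heq ↦ hne (heq ▸ hx)
  have hf := h.cross_next e he
  have hfW := h.next_mem e he
  have hv := h.cross_next _ hfW
  have hvW := h.next_mem _ hfW
  have hev : cross e (σ (σ e)) = -1 := by
    have hsum := h.cross_add_cross hfW e
    rw [h.prev_next e he, cross_same, zero_add, hf, mul_one] at hsum
    have hno' := hno _ hfW
    rw [h.prev_next e he] at hno'
    have := hle _ hvW
    have : cross e (σ (σ e)) ≠ 0 := fun hc ↦ by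
      rw [hzero _ hvW hc, cross_swap] at hv
      omega
    omega
  have hone (x) (hx : x ∈ W) (hc : cross e x = 1) : x = σ e := by
    refine eq_of_cross_eq hf (by rw [hc, hf]) ?_
    rw [cross_same]
    rcases lt_trichotomy (cross x (σ e)) 0 with hk | hk | hk
    · refine (h.cone_empty _ hfW x hx (by rw [cross_swap]; omega) ?_).elim
      have : cross x (σ (σ e)) = 1 - cross x (σ e) := by
        simp only [cross] at *
        linear_combination (-(x.1 * (σ (σ e)).2 - x.2 * (σ (σ e)).1)) * hf +
          (x.1 * (σ e).2 - x.2 * (σ e).1) * hev +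
          (e.1 * x.2 - e.2 * x.1) * hv + hc
      omega
    · exact hk
    · exact (h.cone_empty _ he x hx (by omega) hk).elim
  have hgW := h.prev_mem e he
  have hg := h.cross_prev he
  have hpgW := h.prev_mem _ hgW
  have hgv : π e = σ (σ e) := by
    have hsum := h.cross_add_cross hgW e
    rw [h.next_prev e he, cross_same, add_zero] at hsum
    have hno' := hno _ hgW
    rw [h.next_prev e he] at hno'
    rw [cross_swap (π e) e, hg] at hsum
    have := hle _ hpgW
    have hpg : cross e (π (π e)) ≠ 0 := fun hc ↦ by
      have := hzero _ hpgW hc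
      have h3 := h.next_prev _ hgW
      rw [this] at h3
      rw [h3, cross_swap] at hf
      omega
    rw [← hone _ hpgW (by omega), h.next_prev _ hgW]
  have hsub : W ⊆ {e, σ e, σ (σ e)} := by
    intro x hx
    simp only [Finset.mem_insert, Finset.mem_singleton]
    obtain ⟨h1, h2⟩ := hle x hx
    rcases (by omega : cross e x = -1 ∨ cross e x = 0 ∨ cross e x = 1) with hc | hc | hc
    · right; right
      have hve := h.next_prev e he
      rw [hgv] at hve
      rcases lt_trichotomy (cross (σ (σ e)) x) 0 with hk | hk | hk
      · refine (h.cone_empty _ hfW x hx ?_ (by rw [cross_swap]; omega)).elim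
        have : cross (σ e) x = - cross (σ (σ e)) x - cross e x := by
          simp only [cross] at *
          linear_combination ((σ e).1 * x.2 - (σ e).2 * x.1) * hev -
            ((σ (σ e)).1 * x.2 - (σ (σ e)).2 * x.1) * hf - (e.1 * x.2 - e.2 * x.1) * hv
        omega
      · rcases h.eq_or_eq_neg hvW hx hk with heq | heq
        · exact heq
        · rw [heq, cross_swap, cross_neg_left, neg_neg, cross_swap] at hc
          omega
      · refine (h.cone_empty _ hvW x hx hk ?_).elim
        rw [hve, cross_swap]
        omega
    · exact Or.inl (hzero x hx hc)
    · exact Or.inr (Or.inl (hone x hx hc))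
  have := (Finset.card_le_card hsub).trans Finset.card_le_three
  omega

/-- Contracting a ray `w = π w + σ w` of a fan with at least four rays gives a fan. -/
lemma erase (h : IsUnimodularFan W σ π) {w : ℤ × ℤ} (hw : w ∈ W)
    (h1 : cross (π w) (σ w) = 1) :
    IsUnimodularFan (W.erase w) (Function.update σ (π w) (σ w))
      (Function.update π (σ w) (π w)) := by
  have hp := h.cross_prev hw
  have hs := h.cross_next w hw
  have hpW := h.prev_mem w hw
  have hsW := h.next_mem w hw
  have hpw : π w ≠ w := fun heq ↦ by rw [heq, cross_same] at hp; omega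
  have hsw : σ w ≠ w := fun heq ↦ by rw [heq, cross_same] at hs; omega
  have hσ {u : ℤ × ℤ} (hu : u ∈ W) (hup : u ≠ π w) : σ u ≠ w := fun heq ↦
    hup (by rw [← heq, h.prev_next u hu])
  have hπ {u : ℤ × ℤ} (hu : u ∈ W) (hus : u ≠ σ w) : π u ≠ w := fun heq ↦
    hus (by rw [← heq, h.next_prev u hu])
  constructor
  · intro u hu
    obtain ⟨huw, hu⟩ := Finset.mem_erase.1 hu
    by_cases hup : u = π w
    · rw [hup, Function.update_self]
      exact Finset.mem_erase.2 ⟨hsw, hsW⟩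
    · rw [Function.update_of_ne hup]
      exact Finset.mem_erase.2 ⟨hσ hu hup, h.next_mem u hu⟩
  · intro u hu
    obtain ⟨huw, hu⟩ := Finset.mem_erase.1 hu
    by_cases hup : u = σ w
    · rw [hup, Function.update_self]
      exact Finset.mem_erase.2 ⟨hpw, hpW⟩
    · rw [Function.update_of_ne hup]
      exact Finset.mem_erase.2 ⟨hπ hu hup, h.prev_mem u hu⟩
  · intro u hu
    obtain ⟨huw, hu⟩ := Finset.mem_erase.1 hu
    by_cases hup : u = π w
    · rw [hup, Function.update_self, Function.update_self]
    · rw [Function.update_of_ne hup, Function.update_of_ne, h.prev_next u hu]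
      intro heq
      exact huw (by rw [← h.prev_next u hu, heq, h.prev_next w hw])
  · intro u hu
    obtain ⟨huw, hu⟩ := Finset.mem_erase.1 hu
    by_cases hup : u = σ w
    · rw [hup, Function.update_self, Function.update_self]
    · rw [Function.update_of_ne hup, Function.update_of_ne, h.next_prev u hu]
      intro heq
      exact huw (by rw [← h.next_prev u hu, heq, h.next_prev w hw])
  · intro u hu
    obtain ⟨huw, hu⟩ := Finset.mem_erase.1 hu
    by_cases hup : u = π w
    · rw [hup, Function.update_self, h1]
    · rw [Function.update_of_ne hup, h.cross_next u hu]
  · intro u hu x hx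
    obtain ⟨huw, hu⟩ := Finset.mem_erase.1 hu
    obtain ⟨hxw, hx⟩ := Finset.mem_erase.1 hx
    by_cases hup : u = π w
    · rw [hup, Function.update_self]
      intro hpx hxs
      have hxa : cross w x = cross (π w) x - cross x (σ w) := by
        have := h.cross_add_cross hw x
        rw [h1, one_mul] at this
        rw [cross_swap x w, ← this, cross_swap (π w) x]
        ring
      rcases lt_trichotomy (cross w x) 0 with hk | hk | hk
      · exact h.cone_empty_prev hw hx hpx (by rw [cross_swap]; omega)
      · rcases h.eq_or_eq_neg hw hx hk with heq | heq
        · exact hxw heq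
        · rw [heq, cross_neg_left] at hxs
          omega
      · exact h.cone_empty _ hw _ hx hk hxs
    · rw [Function.update_of_ne hup]
      exact h.cone_empty u hu x hx

lemma next_ne_self (h : IsUnimodularFan W σ π) {u : ℤ × ℤ} (hu : u ∈ W) : σ u ≠ u := fun heq ↦ by
  have := h.cross_next u hu
  rw [heq, cross_same] at this
  omega

lemma next_next_ne_self (h : IsUnimodularFan W σ π) {u : ℤ × ℤ} (hu : u ∈ W) :
    σ (σ u) ≠ u := fun heq ↦ by
  have h1 := h.cross_next u hu
  have h2 := h.cross_next _ (h.next_mem u hu)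
  rw [heq, cross_swap, h1] at h2
  omega

lemma next_injOn (h : IsUnimodularFan W σ π) {u v : ℤ × ℤ} (hu : u ∈ W) (hv : v ∈ W)
    (heq : σ u = σ v) : u = v := by
  rw [← h.prev_next u hu, heq, h.prev_next v hv]

lemma three_le_card (h : IsUnimodularFan W σ π) (hW : W.Nonempty) : 3 ≤ W.card := by
  obtain ⟨u, hu⟩ := hW
  have hb := h.next_mem u hu
  have hc := h.next_mem _ hb
  rw [← Finset.card_eq_three.2 ⟨u, σ u, σ (σ u), (h.next_ne_self hu).symm,
    (h.next_next_ne_self hu).symm, (h.next_ne_self hb).symm, rfl⟩]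
  refine Finset.card_le_card ?_
  simp [Finset.insert_subset_iff, *]

/-- The sum of the self-intersection numbers of a fan with three rays. -/
lemma sum_cross_of_card_eq_three (h : IsUnimodularFan W σ π) (hcard : W.card = 3) :
    ∑ w ∈ W, cross (π w) (σ w) = -3 := by
  obtain ⟨u, hu⟩ : W.Nonempty := Finset.card_pos.1 (by omega)
  have hb := h.next_mem u hu
  have hc := h.next_mem _ hb
  have hub := (h.next_ne_self hu).symm
  have huc := (h.next_next_ne_self hu).symm
  have hbc := (h.next_ne_self hb).symm
  have hW : W = {u, σ u, σ (σ u)} := by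
    symm
    apply Finset.eq_of_subset_of_card_le
    · simp [Finset.insert_subset_iff, *]
    · rw [hcard, Finset.card_eq_three.2 ⟨_, _, _, hub, huc, hbc, rfl⟩]
  have hclose : σ (σ (σ u)) = u := by
    have hmem := h.next_mem _ hc
    rw [hW] at hmem
    simp only [Finset.mem_insert, Finset.mem_singleton] at hmem
    rcases hmem with hm | hm | hm
    · exact hm
    · exact absurd hm (h.next_next_ne_self hb)
    · exact absurd hm (h.next_ne_self hc)
  have hπ : π u = σ (σ u) := by rw [← h.prev_next _ hc, hclose]
  rw [hW, Finset.sum_insert (by simp [hub, huc]), Finset.sum_pair hbc, h.prev_next _ hb,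
    h.prev_next _ hu, hclose, hπ, cross_swap, cross_swap (σ (σ u)) u, cross_swap u (σ u)]
  have h1 := h.cross_next _ hu
  have h2 := h.cross_next _ hb
  have h3 := h.cross_next _ hc
  rw [hclose] at h3
  omega

lemma sum_cross_of_card_eq_four (h : IsUnimodularFan W σ π) (hcard : W.card = 4) :
    ∑ w ∈ W, cross (π w) (σ w) = 0 := by
  obtain ⟨u, hu⟩ : W.Nonempty := Finset.card_pos.1 (by omega)
  have hb := h.next_mem u hu
  have hc := h.next_mem _ hb
  have hd := h.next_mem _ hc
  have hub := (h.next_ne_self hu).symm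
  have huc := (h.next_next_ne_self hu).symm
  have hbc := (h.next_ne_self hb).symm
  have hbd := (h.next_next_ne_self hb).symm
  have hcd := (h.next_ne_self hc).symm
  have hud : u ≠ σ (σ (σ u)) := by
    intro hclose
    obtain ⟨z, hz, hzn⟩ : ∃ z ∈ W, z ∉ ({u, σ u, σ (σ u)} : Finset (ℤ × ℤ)) := by
      by_contra! hsub
      have := (Finset.card_le_card hsub).trans Finset.card_le_three
      omega
    simp only [Finset.mem_insert, Finset.mem_singleton, not_or] at hzn
    obtain ⟨hzu, hzb, hzc⟩ := hzn
    have hσz := h.next_mem z hz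
    have hW : W = {u, σ u, σ (σ u), z} := by
      symm
      apply Finset.eq_of_subset_of_card_le
      · simp [Finset.insert_subset_iff, hu, hb, hc, hz]
      · rw [hcard, Finset.card_insert_of_notMem (by simp [hub, huc, Ne.symm hzu]),
          Finset.card_eq_three.2 ⟨_, _, _, hbc, Ne.symm hzb, Ne.symm hzc, rfl⟩]
    rw [hW] at hσz
    simp only [Finset.mem_insert, Finset.mem_singleton] at hσz
    rcases hσz with hm | hm | hm | hm
    · exact hzc (h.next_injOn hz hc (by rw [hm, ← hclose]))
    · exact hzu (h.next_injOn hz hu hm)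
    · exact hzb (h.next_injOn hz hb hm)
    · exact h.next_ne_self hz hm
  have hW : W = {u, σ u, σ (σ u), σ (σ (σ u))} := by
    symm
    apply Finset.eq_of_subset_of_card_le
    · simp [Finset.insert_subset_iff, *]
    · rw [hcard, Finset.card_insert_of_notMem (by simp [*]),
        Finset.card_eq_three.2 ⟨_, _, _, hbc, hbd, hcd, rfl⟩]
  have hclose : σ (σ (σ (σ u))) = u := by
    have hmem := h.next_mem _ hd
    rw [hW] at hmem
    simp only [Finset.mem_insert, Finset.mem_singleton] at hmem
    rcases hmem with hm | hm | hm | hm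
    · exact hm
    · exact absurd (h.next_injOn hd hu hm).symm hud
    · exact absurd hm (h.next_next_ne_self hc)
    · exact absurd hm (h.next_ne_self hd)
  have hπ : π u = σ (σ (σ u)) := by rw [← h.prev_next _ hd, hclose]
  rw [hW, Finset.sum_insert (by simp [*]), Finset.sum_insert (by simp [*]), Finset.sum_pair hcd,
    h.prev_next _ hb, h.prev_next _ hu, h.prev_next _ hc, hclose, hπ,
    cross_swap (σ u), cross_swap (σ (σ u)) u]
  ring

/-- The sum of the self-intersection numbers of a complete unimodular fan with `N` rays
is `3 N - 12`. -/
theorem sum_cross (h : IsUnimodularFan W σ π) (hW : W.Nonempty) :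
    ∑ w ∈ W, cross (π w) (σ w) = 3 * W.card - 12 := by
  induction hn : W.card using Nat.strong_induction_on generalizing W σ π with
  | _ n ih =>
    have h3 := h.three_le_card hW
    rcases (by omega : n = 3 ∨ n = 4 ∨ 5 ≤ n) with rfl | rfl | h5
    · rw [h.sum_cross_of_card_eq_three hn]; rfl
    · rw [h.sum_cross_of_card_eq_four hn]; rfl
    obtain ⟨w, hw, h1⟩ := h.exists_cross_eq_one (by omega)
    have hcard := Finset.card_erase_of_mem hw
    have hlt := ih (n - 1) (by omega) (h.erase hw h1) (Finset.card_pos.1 (by omega)) (by omega)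
    have hp := h.cross_prev hw
    have hs := h.cross_next w hw
    have hpW := h.prev_mem w hw
    have hsW := h.next_mem w hw
    have hpw : π w ≠ w := fun heq ↦ by rw [heq, cross_same] at hp; omega
    have hsw : σ w ≠ w := h.next_ne_self hw
    have hps : π w ≠ σ w := fun heq ↦ by rw [heq, cross_same] at h1; omega
    have hterm : ∀ u ∈ W.erase w, cross (Function.update π (σ w) (π w) u)
        (Function.update σ (π w) (σ w) u) =
        cross (π u) (σ u) - ((if u = π w then 1 else 0) + if u = σ w then 1 else 0) := by
      intro u hu
      by_cases hup : u = π w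
      · rw [if_pos hup, hup, if_neg hps, Function.update_of_ne hps, Function.update_self,
          h.next_prev w hw]
        have := h.cross_add_cross hw (π (π w))
        rw [h1, h.cross_prev hpW] at this
        linarith
      · rw [if_neg hup, Function.update_of_ne hup]
        by_cases hus : u = σ w
        · rw [if_pos hus, hus, Function.update_self, h.prev_next w hw]
          have := h.cross_add_cross hw (σ (σ w))
          rw [h1, cross_swap (π w), cross_swap (σ w), cross_swap w, h.cross_next _ hsW] at this
          linarith
        · rw [if_neg hus, Function.update_of_ne hus]
          ring
    rw [Finset.sum_congr rfl hterm, Finset.sum_sub_distrib, Finset.sum_add_distrib,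
      Finset.sum_ite_eq', Finset.sum_ite_eq', if_pos (Finset.mem_erase.2 ⟨hpw, hpW⟩),
      if_pos (Finset.mem_erase.2 ⟨hsw, hsW⟩)] at hlt
    rw [← Finset.add_sum_erase W _ hw, h1]
    push_cast [Nat.cast_sub (by omega : 1 ≤ n)] at hlt
    linarith

end IsUnimodularFan

/-- Finitely many lattice vectors closed under a counterclockwise turn are not contained in a
closed half-plane. -/
lemma exists_pos_of_cross_next {T : Finset (ℤ × ℤ)} {σ : ℤ × ℤ → ℤ × ℤ} (hT : T.Nonempty)
    (hσ : ∀ w ∈ T, σ w ∈ T) (hc : ∀ w ∈ T, cross w (σ w) = 1) {g : ℝ × ℝ} (hg : g ≠ 0) :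
    ∃ w ∈ T, 0 < g.1 * w.1 + g.2 * w.2 := by
  by_contra! hneg
  have hg2 : 0 < g.1 ^ 2 + g.2 ^ 2 := by
    by_contra hle
    have h1 : g.1 = 0 := by nlinarith [sq_nonneg g.1, sq_nonneg g.2]
    have h2 : g.2 = 0 := by nlinarith [sq_nonneg g.1, sq_nonneg g.2]
    exact hg (Prod.ext h1 h2)
  set A : ℤ × ℤ → ℝ := fun w ↦ -(g.1 * w.1 + g.2 * w.2) with hA
  set B : ℤ × ℤ → ℝ := fun w ↦ g.1 * w.2 - g.2 * w.1 with hB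
  have hA0 (w) (hw : w ∈ T) : 0 ≤ A w := by have := hneg w hw; simp only [hA]; linarith
  have key (w) (hw : w ∈ T) : B w * A (σ w) - A w * B (σ w) = g.1 ^ 2 + g.2 ^ 2 := by
    have : ((w.1 * (σ w).2 - w.2 * (σ w).1 : ℤ) : ℝ) = 1 := by exact_mod_cast hc w hw
    push_cast at this
    simp only [hA, hB]
    linear_combination (g.1 ^ 2 + g.2 ^ 2) * this
  obtain ⟨w₀, hw₀⟩ := hT
  have hne : (T.filter fun w ↦ 0 < A w).Nonempty := by
    by_contra hemp
    rw [Finset.not_nonempty_iff_eq_empty, Finset.filter_eq_empty_iff] at hemp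
    have h1 := le_antisymm (not_lt.1 (hemp hw₀)) (hA0 _ hw₀)
    have h2 := le_antisymm (not_lt.1 (hemp (hσ _ hw₀))) (hA0 _ (hσ _ hw₀))
    have := key w₀ hw₀
    rw [h1, h2] at this
    linarith
  obtain ⟨w, hw, hmin⟩ := Finset.exists_min_image _ (fun w ↦ B w / A w) hne
  obtain ⟨hwT, hwA⟩ := Finset.mem_filter.1 hw
  have hk := key w hwT
  rcases (hA0 _ (hσ w hwT)).lt_or_eq with hpos | hzero
  · have := hmin (σ w) (Finset.mem_filter.2 ⟨hσ w hwT, hpos⟩)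
    rw [div_le_div_iff₀ hwA hpos] at this
    linarith
  · have hk' := key _ (hσ w hwT)
    rw [← hzero] at hk hk'
    have hB' : B (σ w) < 0 := by nlinarith
    nlinarith [hA0 _ (hσ _ (hσ w hwT))]

/-- The support function of a finite set of lattice points. -/
def supportFn (A : Finset (ℤ × ℤ)) (u : ℤ × ℤ) : ℤ :=
  if h : A.Nonempty then A.sup' h (dot u) else 0

section supportFn

variable {A : Finset (ℤ × ℤ)}

lemma dot_le_supportFn {p : ℤ × ℤ} (hp : p ∈ A) (u : ℤ × ℤ) : dot u p ≤ supportFn A u := by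
  rw [supportFn, dif_pos ⟨p, hp⟩]
  exact Finset.le_sup' (dot u) hp

lemma exists_dot_eq_supportFn (hA : A.Nonempty) (u : ℤ × ℤ) :
    ∃ p ∈ A, dot u p = supportFn A u := by
  obtain ⟨p, hp, h⟩ := Finset.exists_mem_eq_sup' hA (dot u)
  exact ⟨p, hp, by rw [supportFn, dif_pos hA, h]⟩

lemma supportFn_le (hA : A.Nonempty) {u : ℤ × ℤ} {c : ℤ} (h : ∀ p ∈ A, dot u p ≤ c) :
    supportFn A u ≤ c := by
  obtain ⟨p, hp, heq⟩ := exists_dot_eq_supportFn hA u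
  exact heq ▸ h p hp

lemma dot_smul_add (a b : ℤ) (u v p : ℤ × ℤ) :
    dot (a • u + b • v) p = a * dot u p + b * dot v p := by
  simp only [dot, Prod.fst_add, Prod.snd_add, Prod.smul_fst, Prod.smul_snd, smul_eq_mul]
  ring

lemma dot_smul (a : ℤ) (u p : ℤ × ℤ) : dot (a • u) p = a * dot u p := by
  simp only [dot, Prod.smul_fst, Prod.smul_snd, smul_eq_mul]
  ring

lemma mul_supportFn_le (hA : A.Nonempty) {u v z : ℤ × ℤ} {a b m : ℤ} (ha : 0 ≤ a) (hb : 0 ≤ b)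
    (hz : m • z = a • u + b • v) :
    m * supportFn A z ≤ a * supportFn A u + b * supportFn A v := by
  obtain ⟨p, hp, heq⟩ := exists_dot_eq_supportFn hA z
  rw [← heq, ← dot_smul, hz, dot_smul_add]
  have h1 := dot_le_supportFn hp u
  have h2 := dot_le_supportFn hp v
  gcongr

end supportFn

/-- Every lattice vector on the left of a primitive vector `u` can be sheared along `u` and scaled
down to a lattice vector forming a unimodular cone with `u`. -/
lemma exists_cross_eq_one_smul_eq {u v : ℤ × ℤ} (hu : IsCoprime u.1 u.2) (hm : 0 < cross u v) :
    ∃ (z : ℤ × ℤ) (c : ℤ), cross u z = 1 ∧ 0 ≤ c ∧ c < cross u v ∧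
      cross u v • z = c • u + (1 : ℤ) • v := by
  obtain ⟨a, b, hab⟩ := hu
  set m := cross u v with hmdef
  set c₀ := cross (-b, a) v with hc₀
  refine ⟨(-b, a) - (c₀ / m) • u, c₀ % m, ?_, Int.emod_nonneg _ hm.ne', Int.emod_lt_of_pos _ hm, ?_⟩
  · simp only [cross, Prod.fst_sub, Prod.snd_sub, Prod.smul_fst, Prod.smul_snd, smul_eq_mul]
    linear_combination hab
  · have h := Int.emod_add_mul_ediv c₀ m
    have hr : c₀ % m = c₀ - m * (c₀ / m) := by linarith
    rw [hr]
    ext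
    · simp only [Prod.fst_sub, Prod.smul_fst, Prod.fst_add, smul_eq_mul]
      rw [hmdef, hc₀]
      simp only [cross]
      linear_combination v.1 * hab
    · simp only [Prod.snd_sub, Prod.smul_snd, Prod.snd_add, smul_eq_mul]
      rw [hmdef, hc₀]
      simp only [cross]
      linear_combination v.2 * hab

lemma exists_isCoprime_smul_eq {g : ℤ × ℤ} (hg : g ≠ 0) :
    ∃ (k : ℤ) (t : ℤ × ℤ), 0 < k ∧ IsCoprime t.1 t.2 ∧ g = k • t := by
  have hpos : 0 < Int.gcd g.1 g.2 := by
    rw [Int.gcd_pos_iff]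
    by_contra! h0
    exact hg (Prod.ext h0.1 h0.2)
  obtain ⟨x, y, hxy, hx, hy⟩ := Int.exists_gcd_one hpos
  refine ⟨Int.gcd g.1 g.2, (x, y), by exact_mod_cast hpos, Int.isCoprime_iff_gcd_eq_one.2 hxy, ?_⟩
  exact Prod.ext (hx.trans (mul_comm _ _)) (hy.trans (mul_comm _ _))

/-- `I` behaves like the set of interior lattice points of the lattice polygon spanned by `S`. -/
structure IsInteriorPair (S I : Finset (ℤ × ℤ)) : Prop where
  outer_nonempty : S.Nonempty
  inner_nonempty : I.Nonempty
  combo_mem : ∀ p ∈ I, ∀ q ∈ I, ∀ s ∈ S, ∀ (z : ℤ × ℤ) (a b c : ℤ), 0 ≤ a → 0 ≤ b → 0 ≤ c →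
    0 < a + b → (a + b + c) • z = a • p + b • q + c • s → z ∈ I
  exists_margin : ∃ ε : ℝ, 0 < ε ∧ ∀ p ∈ I, ∀ u : ℤ × ℤ,
    dot u p + ε * |(u.1 : ℝ)| ≤ supportFn S u ∧ dot u p + ε * |(u.2 : ℝ)| ≤ supportFn S u
  exists_dot_ne : ∀ u : ℤ × ℤ, u ≠ 0 → ∃ p ∈ I, ∃ q ∈ I, dot u p ≠ dot u q
  exists_separating : ∀ y ∉ I, ∃ f : ℝ × ℝ, ∀ p ∈ I,
    f.1 * p.1 + f.2 * p.2 < f.1 * y.1 + f.2 * y.2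

/-- The distance between the supporting lines of `S` and `I` with outer normal `u`. -/
def gap (S I : Finset (ℤ × ℤ)) (u : ℤ × ℤ) : ℤ := supportFn S u - supportFn I u

namespace IsInteriorPair

variable {S I : Finset (ℤ × ℤ)}

lemma one_le_gap (h : IsInteriorPair S I) {u : ℤ × ℤ} (hu : u ≠ 0) : 1 ≤ gap S I u := by
  obtain ⟨ε, hε, hm⟩ := h.exists_margin
  obtain ⟨p, hp, heq⟩ := exists_dot_eq_supportFn h.inner_nonempty u
  have hlt : ((dot u p : ℤ) : ℝ) < supportFn S u := by
    obtain ⟨h1, h2⟩ := hm p hp u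
    by_cases h0 : u.1 = 0
    · have : (u.2 : ℝ) ≠ 0 := by
        intro h0'
        exact hu (Prod.ext h0 (by exact_mod_cast h0'))
      have := mul_pos hε (abs_pos.2 this)
      linarith
    · have := mul_pos hε (abs_pos.2 (Int.cast_ne_zero (α := ℝ).2 h0))
      linarith
  have : dot u p < supportFn S u := by exact_mod_cast hlt
  rw [gap]
  omega

lemma finite_gap_eq_one (h : IsInteriorPair S I) : {u | gap S I u = 1}.Finite := by
  obtain ⟨ε, hε, hm⟩ := h.exists_margin
  obtain ⟨K, hK⟩ := exists_nat_ge (1 / ε)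
  refine ((Finset.Icc (-(K : ℤ)) K ×ˢ Finset.Icc (-(K : ℤ)) K).finite_toSet).subset fun u hu ↦ ?_
  obtain ⟨p, hp, heq⟩ := exists_dot_eq_supportFn h.inner_nonempty u
  have hu' : supportFn S u = dot u p + 1 := by
    have : gap S I u = 1 := hu
    rw [gap] at this
    omega
  obtain ⟨h1, h2⟩ := hm p hp u
  rw [hu'] at h1 h2
  push_cast at h1 h2
  have bound (x : ℤ) (hx : ε * |(x : ℝ)| ≤ 1) : |x| ≤ K := by
    have : |(x : ℝ)| ≤ K := le_trans (by rw [le_div_iff₀ hε]; linarith) hK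
    exact_mod_cast this
  have hb1 := abs_le.1 (bound u.1 (by linarith))
  have hb2 := abs_le.1 (bound u.2 (by linarith))
  simp only [Finset.coe_product, Finset.coe_Icc, Set.mem_prod, Set.mem_Icc]
  exact ⟨hb1, hb2⟩

/-- On a cone where the support function of `I` is linear, the gap function is convex. -/
lemma mul_gap_le (h : IsInteriorPair S I) {u v z p : ℤ × ℤ} (hp : p ∈ I)
    (hpu : dot u p = supportFn I u) (hpv : dot v p = supportFn I v) {a b m : ℤ} (ha : 0 ≤ a)
    (hb : 0 ≤ b) (hm : 0 < m) (hz : m • z = a • u + b • v) :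
    dot z p = supportFn I z ∧ m * gap S I z ≤ a * gap S I u + b * gap S I v := by
  have h1 := mul_supportFn_le h.inner_nonempty ha hb hz
  have h2 := mul_supportFn_le h.outer_nonempty ha hb hz
  have h3 : m * dot z p = a * supportFn I u + b * supportFn I v := by
    rw [← dot_smul, hz, dot_smul_add, hpu, hpv]
  have h4 : dot z p = supportFn I z := by
    refine le_antisymm (dot_le_supportFn hp z) ?_
    exact le_of_mul_le_mul_left (h3 ▸ h1) hm
  refine ⟨h4, ?_⟩
  simp only [gap, ← h4, mul_sub]
  linarith

lemma isCoprime_of_gap_eq_one (h : IsInteriorPair S I) {u : ℤ × ℤ} (hu : gap S I u = 1) :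
    IsCoprime u.1 u.2 := by
  have hu0 : u ≠ 0 := by
    rintro rfl
    have hz (A : Finset (ℤ × ℤ)) : supportFn A 0 = 0 := by
      by_cases hA : A.Nonempty
      · obtain ⟨p, -, hp⟩ := exists_dot_eq_supportFn hA 0
        rw [← hp]
        simp [dot]
      · rw [supportFn, dif_neg hA]
    simp [gap, hz] at hu
  obtain ⟨k, t, hk, ht, hut⟩ := exists_isCoprime_smul_eq hu0
  have ht0 : t ≠ 0 := by
    rintro rfl
    exact hu0 (by rw [hut, smul_zero])
  obtain ⟨p, hp, hpu⟩ := exists_dot_eq_supportFn h.inner_nonempty u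
  have hle := (h.mul_gap_le hp hpu hpu zero_le_one le_rfl hk
    (show k • t = (1 : ℤ) • u + (0 : ℤ) • u by rw [one_smul, zero_smul, add_zero, hut])).2
  have h1 := h.one_le_gap ht0
  have hk1 : k = 1 := by nlinarith
  rwa [hut, hk1, one_smul]

/-- Moving out an edge of the hull of `I` by one touches `S`: the normal vector `x ↦ cross u x`
of an edge with primitive direction `u` has gap one. -/
lemma gap_normal_eq_one (h : IsInteriorPair S I) {u p : ℤ × ℤ} (hu : IsCoprime u.1 u.2)
    (hp : p ∈ I) (hpu : p + u ∈ I) (hmax : ∀ x ∈ I, cross u x ≤ cross u p) :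
    gap S I (-u.2, u.1) = 1 ∧ dot (-u.2, u.1) p = supportFn I (-u.2, u.1) := by
  have hdot (x : ℤ × ℤ) : dot (-u.2, u.1) x = cross u x := by simp only [dot, cross]; ring
  have hsupp : dot (-u.2, u.1) p = supportFn I (-u.2, u.1) :=
    le_antisymm (dot_le_supportFn hp _)
      (supportFn_le h.inner_nonempty fun x hx ↦ by rw [hdot, hdot]; exact hmax x hx)
  refine ⟨le_antisymm ?_ (h.one_le_gap fun h0 ↦ ?_), hsupp⟩
  · rw [gap, ← hsupp, sub_le_iff_le_add]
    refine supportFn_le h.outer_nonempty fun s hs ↦ ?_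
    rw [hdot, hdot]
    by_contra! hlt
    have hsub : cross u (s - p) = cross u s - cross u p := by
      simp only [cross, Prod.fst_sub, Prod.snd_sub]; ring
    obtain ⟨z, c, hz, hc0, hcm, hzeq⟩ :=
      exists_cross_eq_one_smul_eq hu (show 0 < cross u (s - p) by omega)
    set m := cross u (s - p)
    have hmem : p + z ∈ I := by
      refine h.combo_mem p hp _ hpu s hs (p + z) (m - 1 - c) c 1 (by omega) hc0 zero_le_one
        (by omega) ?_
      rw [show m - 1 - c + c + 1 = m by ring, smul_add, hzeq]
      ext
      · simp only [Prod.fst_add, Prod.smul_fst, Prod.fst_sub, smul_eq_mul]; ring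
      · simp only [Prod.snd_add, Prod.smul_snd, Prod.snd_sub, smul_eq_mul]; ring
    have h1 := hmax _ hmem
    have : cross u (p + z) = cross u p + cross u z := by
      simp only [cross, Prod.fst_add, Prod.snd_add]; ring
    omega
  · obtain ⟨h1, h2⟩ := Prod.mk.inj h0
    rw [h2, neg_eq_zero.1 h1] at hu
    exact not_isCoprime_zero_zero hu

end IsInteriorPair

namespace IsInteriorPair

variable {S I : Finset (ℤ × ℤ)}

/-- The first edge normal of the hull of `I` met when turning counterclockwise from `u`. -/
lemma exists_edge_normal (h : IsInteriorPair S I) {u : ℤ × ℤ} (hu : u ≠ 0) :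
    ∃ p ∈ I, ∃ e : ℤ × ℤ, dot u p = supportFn I u ∧ dot e p = supportFn I e ∧
      gap S I e = 1 ∧ 0 < cross u e := by
  obtain ⟨p₀, hp₀, hp₀u⟩ := exists_dot_eq_supportFn h.inner_nonempty u
  obtain ⟨p, hp, hpmax⟩ := Finset.exists_max_image (I.filter fun x ↦ dot u x = supportFn I u)
    (cross u) ⟨p₀, Finset.mem_filter.2 ⟨hp₀, hp₀u⟩⟩
  obtain ⟨hpI, hpu⟩ := Finset.mem_filter.1 hp
  have hne : (I.filter fun x ↦ dot u x < dot u p).Nonempty := by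
    by_contra hemp
    rw [Finset.not_nonempty_iff_eq_empty, Finset.filter_eq_empty_iff] at hemp
    have hall (x) (hx : x ∈ I) : dot u x = dot u p :=
      le_antisymm (hpu ▸ dot_le_supportFn hx u) (not_lt.1 (hemp hx))
    obtain ⟨a, ha, b, hb, hab⟩ := h.exists_dot_ne u hu
    exact hab (by rw [hall a ha, hall b hb])
  obtain ⟨q, hq, hqmax⟩ := Finset.exists_max_image _
    (fun x ↦ ((cross u x - cross u p : ℤ) : ℚ) / ((dot u p - dot u x : ℤ) : ℚ)) hne
  obtain ⟨hqI, hqu⟩ := Finset.mem_filter.1 hq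
  have hratio (x) (hx : x ∈ I) : (cross u x - cross u p) * (dot u p - dot u q) ≤
      (cross u q - cross u p) * (dot u p - dot u x) := by
    have hxle : dot u x ≤ dot u p := hpu ▸ dot_le_supportFn hx u
    rcases hxle.lt_or_eq with hlt | heq
    · have h1 := hqmax x (Finset.mem_filter.2 ⟨hx, hlt⟩)
      rw [div_le_div_iff₀ (by exact_mod_cast sub_pos.2 hlt) (by exact_mod_cast sub_pos.2 hqu)] at h1
      exact_mod_cast h1
    · have h1 := hpmax x (Finset.mem_filter.2 ⟨hx, heq.trans hpu⟩)
      rw [heq, sub_self, mul_zero]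
      exact mul_nonpos_of_nonpos_of_nonneg (by omega) (by omega)
  have hqp : q - p ≠ 0 := fun h0 ↦ by
    rw [sub_eq_zero.1 h0] at hqu
    exact lt_irrefl _ hqu
  obtain ⟨k, t, hk, ht, hkt⟩ := exists_isCoprime_smul_eq hqp
  have hkt1 : q.1 - p.1 = k * t.1 := congrArg Prod.fst hkt
  have hkt2 : q.2 - p.2 = k * t.2 := congrArg Prod.snd hkt
  have hu2 : 0 < u.1 ^ 2 + u.2 ^ 2 := by
    by_contra hle
    have h1 : u.1 = 0 := by nlinarith [sq_nonneg u.1, sq_nonneg u.2]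
    have h2 : u.2 = 0 := by nlinarith [sq_nonneg u.1, sq_nonneg u.2]
    exact hu (Prod.ext h1 h2)
  have hleft (x) (hx : x ∈ I) : cross (-t) x ≤ cross (-t) q := by
    have h1 := hratio x hx
    have h2 : (u.1 ^ 2 + u.2 ^ 2) * k * (cross (-t) x - cross (-t) q) ≤ 0 := by
      simp only [cross, dot, Prod.fst_neg, Prod.snd_neg] at *
      have e1 : q.1 = p.1 + k * t.1 := by linarith
      have e2 : q.2 = p.2 + k * t.2 := by linarith
      rw [e1, e2] at h1 ⊢
      linarith
    have h3 : 0 < (u.1 ^ 2 + u.2 ^ 2) * k := mul_pos hu2 hk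
    by_contra! hlt
    nlinarith
  obtain ⟨s, hs⟩ := h.outer_nonempty
  have hmem : q + -t ∈ I := by
    refine h.combo_mem q hqI p hpI s hs _ (k - 1) 1 0 (by omega) zero_le_one le_rfl (by omega) ?_
    ext
    · simp only [Prod.fst_add, Prod.smul_fst, Prod.fst_neg, smul_eq_mul]
      linarith
    · simp only [Prod.snd_add, Prod.smul_snd, Prod.snd_neg, smul_eq_mul]
      linarith
  obtain ⟨hgap, hsupp⟩ := h.gap_normal_eq_one (u := -t) (IsCoprime.neg_neg ht) hqI hmem hleft
  refine ⟨p, hpI, _, hpu, ?_, hgap, ?_⟩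
  · rw [← hsupp]
    simp only [dot, Prod.fst_neg, Prod.snd_neg]
    linear_combination (-t.2) * hkt1 + t.1 * hkt2
  · simp only [cross, dot, Prod.fst_neg, Prod.snd_neg] at *
    by_contra! hle
    have hdiff : k * (u.1 * t.1 + u.2 * t.2) = u.1 * q.1 + u.2 * q.2 - (u.1 * p.1 + u.2 * p.2) := by
      linear_combination (-u.1) * hkt1 - u.2 * hkt2
    have hnn : 0 ≤ u.1 * t.1 + u.2 * t.2 := by linarith
    nlinarith [mul_nonneg hk.le hnn]

/-- Every normal of gap one has a counterclockwise neighbour of gap one. -/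
lemma exists_next (h : IsInteriorPair S I) {u : ℤ × ℤ} (hu : gap S I u = 1) :
    ∃ v, gap S I v = 1 ∧ cross u v = 1 ∧
      (∃ p ∈ I, dot u p = supportFn I u ∧ dot v p = supportFn I v) ∧
      ∀ x, gap S I x = 1 → 0 < cross u x → 0 < cross x v → False := by
  have hcop := h.isCoprime_of_gap_eq_one hu
  have hu0 : u ≠ 0 := by
    rintro rfl
    exact not_isCoprime_zero_zero hcop
  obtain ⟨p, hp, e, hpu, hpe, he, hue⟩ := h.exists_edge_normal hu0
  have hmem {z : ℤ × ℤ} (hz : cross u z = 1) (hle : gap S I z ≤ 1) : gap S I z = 1 := by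
    refine le_antisymm hle (h.one_le_gap ?_)
    rintro rfl
    simp [cross] at hz
  obtain ⟨z, c, hz, hc, hcm, hzeq⟩ := exists_cross_eq_one_smul_eq hcop hue
  obtain ⟨hpz, hgz⟩ := h.mul_gap_le hp hpu hpe hc zero_le_one hue hzeq
  rw [hu, he] at hgz
  have hz1 : gap S I z = 1 := hmem hz (by by_contra! hlt; nlinarith)
  have hfin : {v | gap S I v = 1 ∧ cross u v = 1 ∧ dot v p = supportFn I v}.Finite :=
    h.finite_gap_eq_one.subset fun v hv ↦ hv.1
  obtain ⟨v, hv, hvmax⟩ := Finset.exists_max_image hfin.toFinset (dot u)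
    ⟨z, hfin.mem_toFinset.2 ⟨hz1, hz, hpz⟩⟩
  obtain ⟨hv1, huv, hpv⟩ := hfin.mem_toFinset.1 hv
  refine ⟨v, hv1, huv, ⟨p, hp, hpu, hpv⟩, fun x hx hux hxv ↦ ?_⟩
  have hxeq : x = cross x v • u + cross u x • v := by
    simp only [cross] at *
    ext
    · simp only [Prod.fst_add, Prod.smul_fst, smul_eq_mul]
      linear_combination (-x.1) * huv
    · simp only [Prod.snd_add, Prod.smul_snd, smul_eq_mul]
      linear_combination (-x.2) * huv
  obtain ⟨hpx, -⟩ := h.mul_gap_le hp hpu hpv hxv.le hux.le one_pos ((one_smul ℤ x).trans hxeq)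
  set a := cross x v
  set b := cross u x
  have hsum : gap S I (u + v) ≤ 1 ∧ dot (u + v) p = supportFn I (u + v) := by
    rcases le_total b a with hab | hab
    · obtain ⟨h1, h2⟩ := h.mul_gap_le (z := u + v) hp hpx hpv zero_le_one (sub_nonneg.2 hab) hxv
        (by rw [hxeq]; module)
      rw [hx, hv1] at h2
      exact ⟨by by_contra! hlt; nlinarith, h1⟩
    · obtain ⟨h1, h2⟩ := h.mul_gap_le (z := u + v) hp hpx hpu zero_le_one (sub_nonneg.2 hab) hux
        (by rw [hxeq]; module)
      rw [hx, hu] at h2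
      exact ⟨by by_contra! hlt; nlinarith, h1⟩
  have hcross : cross u (u + v) = 1 := by
    rw [← huv]; simp only [cross, Prod.fst_add, Prod.snd_add]; ring
  have hle := hvmax (u + v) (hfin.mem_toFinset.2 ⟨hmem hcross hsum.1, hcross, hsum.2⟩)
  have hu2 : dot u (u + v) = dot u v + (u.1 ^ 2 + u.2 ^ 2) := by
    simp only [dot, Prod.fst_add, Prod.snd_add]; ring
  have h1 : u.1 = 0 := by nlinarith [sq_nonneg u.1, sq_nonneg u.2]
  have h2 : u.2 = 0 := by nlinarith [sq_nonneg u.1, sq_nonneg u.2]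
  exact hu0 (Prod.ext h1 h2)

/-- The normals of gap one are the rays of a unimodular fan refining the normal fan of the hull
of `I`. -/
lemma exists_fan (h : IsInteriorPair S I) : ∃ (W : Finset (ℤ × ℤ)) (σ π : ℤ × ℤ → ℤ × ℤ),
    IsUnimodularFan W σ π ∧ W.Nonempty ∧ (∀ w ∈ W, gap S I w = 1) ∧
    ∀ w ∈ W, ∃ p ∈ I, dot w p = supportFn I w ∧ dot (σ w) p = supportFn I (σ w) := by
  choose! σ hσ using fun (u : ℤ × ℤ) (hu : gap S I u = 1) ↦ h.exists_next hu
  set W := h.finite_gap_eq_one.toFinset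
  have hW {u : ℤ × ℤ} : u ∈ W ↔ gap S I u = 1 := h.finite_gap_eq_one.mem_toFinset
  have hmaps : ∀ u ∈ W, σ u ∈ W := fun u hu ↦ hW.2 (hσ u (hW.1 hu)).1
  have hinj : Set.InjOn σ W := by
    intro u hu v hv heq
    have h1 := (hσ u (hW.1 hu)).2
    have h2 := (hσ v (hW.1 hv)).2
    rw [← heq] at h2
    have huv : cross u v = 0 := by
      rcases lt_trichotomy (cross u v) 0 with hlt | h0 | hlt
      · exact (h2.2.2 u (hW.1 hu) (by rw [cross_swap]; omega) (by omega)).elim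
      · exact h0
      · exact (h1.2.2 v (hW.1 hv) hlt (by omega)).elim
    exact eq_of_cross_eq h1.1 (by rw [huv, cross_same]) (by omega)
  have hsurj : Set.SurjOn σ W W :=
    Finset.surjOn_of_injOn_of_card_le σ (fun u hu ↦ hmaps u hu) hinj le_rfl
  have hW0 : W.Nonempty := by
    obtain ⟨p, -, e, -, -, he, -⟩ := h.exists_edge_normal (u := (1, 0)) (by simp)
    exact ⟨e, hW.2 he⟩
  refine ⟨W, σ, Function.invFunOn σ W, ⟨hmaps, ?_, ?_, ?_, ?_, ?_⟩, hW0, fun w ↦ hW.1, ?_⟩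
  · exact fun u hu ↦ Function.invFunOn_mem (hsurj hu)
  · exact fun u hu ↦ hinj.leftInvOn_invFunOn hu
  · exact fun u hu ↦ Function.invFunOn_eq (hsurj hu)
  · exact fun u hu ↦ (hσ u (hW.1 hu)).2.1
  · exact fun u hu x hx ↦ (hσ u (hW.1 hu)).2.2.2 x (hW.1 hx)
  · exact fun u hu ↦ (hσ u (hW.1 hu)).2.2.1

end IsInteriorPair

/-- The solution `y` of `dot u y = α` and `dot v y = β`, for a unimodular basis `u`, `v`. -/
def solveDot (u v : ℤ × ℤ) (α β : ℤ) : ℤ × ℤ := (α * v.2 - β * u.2, β * u.1 - α * v.1)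

lemma dot_solveDot_left {u v : ℤ × ℤ} (h : cross u v = 1) (α β : ℤ) :
    dot u (solveDot u v α β) = α := by
  simp only [dot, cross, solveDot] at *
  linear_combination α * h

lemma dot_solveDot_right {u v : ℤ × ℤ} (h : cross u v = 1) (α β : ℤ) :
    dot v (solveDot u v α β) = β := by
  simp only [dot, cross, solveDot] at *
  linear_combination β * h

lemma eq_of_dot_eq {u v x y : ℤ × ℤ} (h : cross u v = 1) (hu : dot u x = dot u y)
    (hv : dot v x = dot v y) : x = y := by
  simp only [dot, cross] at *
  ext
  · linear_combination (y.1 - x.1) * h + v.2 * hu - u.2 * hv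
  · linear_combination (y.2 - x.2) * h + u.1 * hv - v.1 * hu

/-- The lattice length of the edge with outer normal `w` of the polygon cut out by the
inequalities `dot x y ≤ H x`, where `π w` and `σ w` are the normals of the adjacent edges. -/
def edgeLength (σ π : ℤ × ℤ → ℤ × ℤ) (H : ℤ × ℤ → ℤ) (w : ℤ × ℤ) : ℤ :=
  H (π w) + H (σ w) - cross (π w) (σ w) * H w

/-- The lattice points of the edge with outer normal `w`, except for its first vertex. -/
def edgePoints (σ π : ℤ × ℤ → ℤ × ℤ) (H : ℤ × ℤ → ℤ) (w : ℤ × ℤ) : Finset (ℤ × ℤ) :=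
  (Finset.Icc 1 (edgeLength σ π H w)).image fun k ↦ solveDot (π w) w (H (π w) - k) (H w)

namespace IsUnimodularFan

variable {W : Finset (ℤ × ℤ)} {σ π : ℤ × ℤ → ℤ × ℤ} {H : ℤ × ℤ → ℤ} {w : ℤ × ℤ}

lemma card_edgePoints (h : IsUnimodularFan W σ π) (hw : w ∈ W) :
    (edgePoints σ π H w).card = (edgeLength σ π H w).toNat := by
  rw [edgePoints, Finset.card_image_of_injective, Int.card_Icc, add_sub_cancel_right]
  intro k l hkl
  have := congrArg (dot (π w)) hkl
  simp only [dot_solveDot_left (h.cross_prev hw)] at this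
  omega

lemma mem_edgePoints (h : IsUnimodularFan W σ π) (hw : w ∈ W) {y : ℤ × ℤ} :
    y ∈ edgePoints σ π H w ↔
      dot w y = H w ∧ dot (π w) y < H (π w) ∧ dot (σ w) y ≤ H (σ w) := by
  have hsum := h.dot_add_dot hw y
  have hc := h.cross_prev hw
  simp only [edgePoints, Finset.mem_image, Finset.mem_Icc, edgeLength]
  constructor
  · rintro ⟨k, ⟨hk1, hk2⟩, rfl⟩
    rw [dot_solveDot_left hc, dot_solveDot_right hc] at *
    exact ⟨rfl, by omega, by omega⟩
  · rintro ⟨h1, h2, h3⟩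
    rw [h1] at hsum
    refine ⟨H (π w) - dot (π w) y, ⟨by omega, by omega⟩, eq_of_dot_eq hc ?_ ?_⟩
    · rw [dot_solveDot_left hc]; ring
    · rw [dot_solveDot_right hc, h1]

/-- A set of rays closed under taking the previous ray is closed under taking the next ray. -/
lemma next_mem_of_prev_mem (h : IsUnimodularFan W σ π) {T : Finset (ℤ × ℤ)} (hT : T ⊆ W)
    (hπ : ∀ u ∈ T, π u ∈ T) {u : ℤ × ℤ} (hu : u ∈ T) : σ u ∈ T := by
  have hinj : Set.InjOn π T := fun x hx y hy hxy ↦ by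
    rw [← h.next_prev x (hT hx), hxy, h.next_prev y (hT hy)]
  obtain ⟨x, hx, rfl⟩ := Finset.surjOn_of_injOn_of_card_le π (fun u hu ↦ hπ u hu) hinj le_rfl hu
  rwa [h.next_prev x (hT hx)]

/-- A nonzero linear functional lies in the cone of two consecutive rays of a fan. -/
lemma exists_mem_cone (h : IsUnimodularFan W σ π) (hW : W.Nonempty) {f : ℝ × ℝ} (hf : f ≠ 0) :
    ∃ w ∈ W, 0 ≤ w.1 * f.2 - w.2 * f.1 ∧ 0 < f.1 * (σ w).2 - f.2 * (σ w).1 := by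
  obtain ⟨u, hu, hpos⟩ := exists_pos_of_cross_next hW h.next_mem h.cross_next
    (g := (f.2, -f.1)) (fun h0 ↦ hf (by simpa [Prod.ext_iff, and_comm] using h0))
  by_contra! hno
  set T := W.filter fun w ↦ 0 ≤ (w.1 : ℝ) * f.2 - w.2 * f.1
  have hTW : T ⊆ W := Finset.filter_subset _ _
  obtain ⟨x, hx, hneg⟩ := exists_pos_of_cross_next (T := T) (σ := σ) (g := (-f.2, f.1))
    ⟨u, Finset.mem_filter.2 ⟨hu, by simp only at hpos; linarith⟩⟩
    (fun w hw ↦ by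
      obtain ⟨hw, hw0⟩ := Finset.mem_filter.1 hw
      exact Finset.mem_filter.2 ⟨h.next_mem w hw, by linarith [hno w hw hw0]⟩)
    (fun w hw ↦ h.cross_next w (hTW hw))
    (fun h0 ↦ hf (by simpa [Prod.ext_iff, and_comm] using h0))
  have := (Finset.mem_filter.1 hx).2
  simp only at hneg
  linarith

end IsUnimodularFan

namespace IsInteriorPair

variable {S I W : Finset (ℤ × ℤ)} {σ π : ℤ × ℤ → ℤ × ℤ}

/-- A lattice point outside `I` in the hull of `S` lies on a supporting line of `S` whose normal
is a ray of the fan. -/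
lemma exists_dot_eq (hS : IsUnimodularFan W σ π) (h : IsInteriorPair S I) (hW : W.Nonempty)
    (hgap : ∀ w ∈ W, gap S I w = 1)
    (hvert : ∀ w ∈ W, ∃ p ∈ I, dot w p = supportFn I w ∧ dot (σ w) p = supportFn I (σ w))
    {y : ℤ × ℤ} (hy : y ∉ I) (hyS : ∀ u, dot u y ≤ supportFn S u) :
    ∃ w ∈ W, dot w y = supportFn S w := by
  obtain ⟨f, hf⟩ := h.exists_separating y hy
  have hf0 : f ≠ 0 := by
    rintro rfl
    obtain ⟨p, hp⟩ := h.inner_nonempty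
    simpa using hf p hp
  obtain ⟨w, hw, h0, h1⟩ := hS.exists_mem_cone hW hf0
  obtain ⟨p, hp, hpw, hps⟩ := hvert w hw
  have hwS := hgap w hw
  have hσS := hgap _ (hS.next_mem w hw)
  rw [gap] at hwS hσS
  by_contra! hne
  have hw' := lt_of_le_of_ne (hyS w) (hne w hw)
  have hσ' := lt_of_le_of_ne (hyS (σ w)) (hne _ (hS.next_mem w hw))
  have h2 : dot w y ≤ dot w p := by omega
  have h3 : dot (σ w) y ≤ dot (σ w) p := by omega
  have hc := hS.cross_next w hw
  have hlt := hf p hp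
  simp only [dot, cross] at h2 h3 hc
  have h2' : (w.1 : ℝ) * y.1 + w.2 * y.2 ≤ w.1 * p.1 + w.2 * p.2 := by exact_mod_cast h2
  have h3' : ((σ w).1 : ℝ) * y.1 + (σ w).2 * y.2 ≤ (σ w).1 * p.1 + (σ w).2 * p.2 := by
    exact_mod_cast h3
  have hc' : (w.1 : ℝ) * (σ w).2 - w.2 * (σ w).1 = 1 := by exact_mod_cast hc
  have key : f.1 * y.1 + f.2 * y.2 - (f.1 * p.1 + f.2 * p.2) =
      (f.1 * (σ w).2 - f.2 * (σ w).1) * ((w.1 : ℝ) * y.1 + w.2 * y.2 - (w.1 * p.1 + w.2 * p.2)) +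
      (w.1 * f.2 - w.2 * f.1) *
        ((σ w).1 * y.1 + (σ w).2 * y.2 - ((σ w).1 * p.1 + (σ w).2 * p.2)) := by
    linear_combination (-(f.1 * y.1 + f.2 * y.2 - (f.1 * p.1 + f.2 * p.2))) * hc'
  nlinarith [mul_nonneg h1.le (sub_nonneg.2 h2'), mul_nonneg h0 (sub_nonneg.2 h3')]

lemma exists_mem_edgePoints (hS : IsUnimodularFan W σ π) (h : IsInteriorPair S I)
    (hW : W.Nonempty) (hgap : ∀ w ∈ W, gap S I w = 1)
    (hvert : ∀ w ∈ W, ∃ p ∈ I, dot w p = supportFn I w ∧ dot (σ w) p = supportFn I (σ w))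
    {y : ℤ × ℤ} (hy : y ∉ I) (hyS : ∀ u, dot u y ≤ supportFn S u) :
    ∃ w ∈ W, y ∈ edgePoints σ π (supportFn S) w := by
  obtain ⟨w, hw, hwy⟩ := exists_dot_eq hS h hW hgap hvert hy hyS
  by_contra! hno
  set T := W.filter fun w ↦ dot w y = supportFn S w
  have hTW : T ⊆ W := Finset.filter_subset _ _
  have hπ : ∀ u ∈ T, π u ∈ T := fun u hu ↦ by
    obtain ⟨hu, huy⟩ := Finset.mem_filter.1 hu
    have := hno u hu
    rw [hS.mem_edgePoints hu] at this
    refine Finset.mem_filter.2 ⟨hS.prev_mem u hu, ?_⟩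
    by_contra hne
    exact this ⟨huy, lt_of_le_of_ne (hyS _) hne, hyS _⟩
  obtain ⟨q, hq⟩ := h.inner_nonempty
  obtain ⟨x, hx, hpos⟩ := exists_pos_of_cross_next (T := T) (σ := σ)
    (g := ((q.1 : ℝ) - y.1, (q.2 : ℝ) - y.2)) ⟨w, Finset.mem_filter.2 ⟨hw, hwy⟩⟩
    (fun u hu ↦ hS.next_mem_of_prev_mem hTW hπ hu) (fun u hu ↦ hS.cross_next u (hTW hu))
    (fun h0 ↦ hy (by
      have : q = y := by simpa [Prod.ext_iff, sub_eq_zero] using h0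
      rwa [← this]))
  obtain ⟨hxW, hxy⟩ := Finset.mem_filter.1 hx
  have h1 := hgap x hxW
  have h2 := dot_le_supportFn hq x
  rw [gap] at h1
  have h3 : dot x q < dot x y := by omega
  have h4 : ((dot x q : ℤ) : ℝ) < (dot x y : ℤ) := by exact_mod_cast h3
  simp only [dot] at h4
  push_cast at h4
  simp only at hpos
  linarith

lemma edgeLength_nonneg (hS : IsUnimodularFan W σ π) (h : IsInteriorPair S I)
    {w : ℤ × ℤ} (hw : w ∈ W) : 0 ≤ edgeLength σ π (supportFn S) w := by
  obtain ⟨z, hz, hzw⟩ := exists_dot_eq_supportFn h.outer_nonempty w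
  have := hS.dot_add_dot hw z
  have h1 := dot_le_supportFn hz (π w)
  have h2 := dot_le_supportFn hz (σ w)
  rw [edgeLength, ← hzw]
  omega

/-- The points of the edges of the hull of `I` belong to `I`. -/
lemma edgePoints_subset (hS : IsUnimodularFan W σ π) (h : IsInteriorPair S I)
    (hvert : ∀ w ∈ W, ∃ p ∈ I, dot w p = supportFn I w ∧ dot (σ w) p = supportFn I (σ w))
    {w : ℤ × ℤ} (hw : w ∈ W) : edgePoints σ π (supportFn I) w ⊆ I := by
  intro y hy
  obtain ⟨hy1, hy2, hy3⟩ := (hS.mem_edgePoints hw).1 hy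
  obtain ⟨p, hp, hp1, hp2⟩ := hvert _ (hS.prev_mem w hw)
  rw [hS.next_prev w hw] at hp2
  obtain ⟨q, hq, hq1, hq2⟩ := hvert w hw
  obtain ⟨s, hs⟩ := h.outer_nonempty
  have hsy := hS.dot_add_dot hw y
  have hsq := hS.dot_add_dot hw q
  rw [hy1] at hsy
  rw [hq1] at hsq
  refine h.combo_mem p hp q hq s hs y (supportFn I (σ w) - dot (σ w) y)
    (supportFn I (π w) - dot (π w) y) 0 (by omega) (by omega) le_rfl (by omega) ?_
  have hadd (u : ℤ × ℤ) (a b : ℤ) : dot u (a • p + b • q + (0 : ℤ) • s) =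
      a * dot u p + b * dot u q := by
    simp only [dot, Prod.fst_add, Prod.snd_add, Prod.smul_fst, Prod.smul_snd, smul_eq_mul]
    ring
  have hmul (u : ℤ × ℤ) (a : ℤ) : dot u (a • y) = a * dot u y := by
    simp only [dot, Prod.smul_fst, Prod.smul_snd, smul_eq_mul]
    ring
  refine eq_of_dot_eq (hS.cross_prev hw) ?_ ?_
  · rw [hadd, hmul, hp1]
    linear_combination (supportFn I (π w) - dot (π w) y) * (hsy - hsq + hq2)
  · rw [hadd, hmul, hp2, hy1, hq1]
    ring

/-- Two rays supporting the hull of `I` in the same point, which is not the first vertex of the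
edge with normal `w`. -/
lemma cross_nonpos_of_mem_edgePoints (hS : IsUnimodularFan W σ π)
    (hvert : ∀ w ∈ W, ∃ p ∈ I, dot w p = supportFn I w ∧ dot (σ w) p = supportFn I (σ w))
    {v w y : ℤ × ℤ} (hw : w ∈ W) (hyw : y ∈ edgePoints σ π (supportFn I) w)
    (hyv : dot v y = supportFn I v) : cross v w ≤ 0 := by
  obtain ⟨hy1, hy2, -⟩ := (hS.mem_edgePoints hw).1 hyw
  obtain ⟨p, hp, hp1, hp2⟩ := hvert _ (hS.prev_mem w hw)
  rw [hS.next_prev w hw, ← hy1] at hp2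
  rw [← hp1] at hy2
  have hpv := dot_le_supportFn hp v
  rw [← hyv] at hpv
  have hc := hS.cross_prev hw
  have key : dot v p - dot v y = (dot (π w) p - dot (π w) y) * cross v w := by
    simp only [dot, cross] at *
    linear_combination (-(v.1 * (p.1 - y.1) + v.2 * (p.2 - y.2))) * hc +
      (v.1 * (-(π w).2) + v.2 * (π w).1) * hp2
  by_contra! hlt
  nlinarith [mul_pos (sub_pos.2 hy2) hlt]

lemma pairwiseDisjoint_edgePoints (hS : IsUnimodularFan W σ π) (h : IsInteriorPair S I)
    (hvert : ∀ w ∈ W, ∃ p ∈ I, dot w p = supportFn I w ∧ dot (σ w) p = supportFn I (σ w)) :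
    (W : Set (ℤ × ℤ)).PairwiseDisjoint (edgePoints σ π (supportFn I)) := by
  intro v hv w hw hvw
  refine Finset.disjoint_left.2 fun y hyv hyw ↦ ?_
  have hv1 := ((hS.mem_edgePoints hv).1 hyv).1
  have hw1 := ((hS.mem_edgePoints hw).1 hyw).1
  have h1 := cross_nonpos_of_mem_edgePoints hS hvert hw hyw hv1
  have h2 := cross_nonpos_of_mem_edgePoints hS hvert hv hyv hw1
  rw [cross_swap] at h2
  rcases hS.eq_or_eq_neg hv hw (by omega) with rfl | rfl
  · exact hvw rfl
  have hv0 : v ≠ 0 := by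
    rintro rfl
    have := hS.cross_prev hv
    simp [cross] at this
  have hneg (x : ℤ × ℤ) : dot (-v) x = -dot v x := by
    simp only [dot, Prod.fst_neg, Prod.snd_neg]; ring
  have hconst (p) (hp : p ∈ I) : dot v p = dot v y := by
    have h3 := dot_le_supportFn hp v
    have h4 := dot_le_supportFn hp (-v)
    rw [← hw1, hneg, hneg] at h4
    omega
  obtain ⟨p, hp, q, hq, hpq⟩ := h.exists_dot_ne v hv0
  exact hpq (by rw [hconst p hp, hconst q hq])

/-- The number of lattice points outside `I` in the hull of `S` is bounded by the number of
points of `I` on the boundary of the hull of `I`. -/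
theorem exists_card_le (h : IsInteriorPair S I) : ∃ B C : Finset (ℤ × ℤ),
    (∀ y ∉ I, (∀ u, dot u y ≤ supportFn S u) → y ∈ B) ∧
    (∀ y ∈ C, y ∈ I ∧ ∃ w, w ≠ 0 ∧ dot w y = supportFn I w) ∧ B.card ≤ C.card + 9 := by
  obtain ⟨W, σ, π, hS, hW, hgap, hvert⟩ := h.exists_fan
  refine ⟨W.biUnion (edgePoints σ π (supportFn S)), W.biUnion (edgePoints σ π (supportFn I)),
    fun y hy hyS ↦ Finset.mem_biUnion.2 (exists_mem_edgePoints hS h hW hgap hvert hy hyS),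
    fun y hy ↦ ?_, ?_⟩
  · obtain ⟨w, hw, hyw⟩ := Finset.mem_biUnion.1 hy
    refine ⟨edgePoints_subset hS h hvert hw hyw, w, ?_, ((hS.mem_edgePoints hw).1 hyw).1⟩
    rintro rfl
    have := hS.cross_prev hw
    simp [cross] at this
  have hB : ((W.biUnion (edgePoints σ π (supportFn S))).card : ℤ) ≤
      ∑ w ∈ W, edgeLength σ π (supportFn S) w := by
    refine (Nat.cast_le.2 Finset.card_biUnion_le).trans ?_
    rw [Nat.cast_sum]
    refine Finset.sum_le_sum fun w hw ↦ ?_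
    rw [hS.card_edgePoints hw, Int.toNat_of_nonneg (edgeLength_nonneg hS h hw)]
  have hC : ∑ w ∈ W, edgeLength σ π (supportFn I) w ≤
      ((W.biUnion (edgePoints σ π (supportFn I))).card : ℤ) := by
    rw [Finset.card_biUnion (pairwiseDisjoint_edgePoints hS h hvert), Nat.cast_sum]
    refine Finset.sum_le_sum fun w hw ↦ ?_
    rw [hS.card_edgePoints hw]
    exact Int.self_le_toNat _
  have hdiff : ∑ w ∈ W, edgeLength σ π (supportFn S) w =
      ∑ w ∈ W, edgeLength σ π (supportFn I) w + ∑ w ∈ W, (2 - cross (π w) (σ w)) := by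
    rw [← Finset.sum_add_distrib]
    refine Finset.sum_congr rfl fun w hw ↦ ?_
    have h1 := hgap w hw
    have h2 := hgap _ (hS.prev_mem w hw)
    have h3 := hgap _ (hS.next_mem w hw)
    simp only [gap, edgeLength] at *
    linear_combination h2 + h3 - cross (π w) (σ w) * h1
  have hsum := hS.sum_cross hW
  have hcard := hS.three_le_card hW
  rw [Finset.sum_sub_distrib, hsum, Finset.sum_const, nsmul_eq_mul] at hdiff
  omega

end IsInteriorPair

open Filter Topology in
lemma eventually_add_smul_mem_of_mem_interior {s : Set (ℝ × ℝ)} {x : ℝ × ℝ} (hx : x ∈ interior s)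
    (v : ℝ × ℝ) : ∀ᶠ t in 𝓝[>] (0 : ℝ), x + t • v ∈ s := by
  have hcont : Tendsto (fun t : ℝ ↦ x + t • v) (𝓝[>] 0) (𝓝 x) := by
    have : Tendsto (fun t : ℝ ↦ x + t • v) (𝓝 0) (𝓝 (x + (0 : ℝ) • v)) :=
      (by fun_prop : Continuous fun t : ℝ ↦ x + t • v).tendsto 0
    rw [zero_smul, add_zero] at this
    exact this.mono_left nhdsWithin_le_nhds
  exact hcont.eventually (mem_interior_iff_mem_nhds.1 hx)

lemma le_supportFn_of_mem_convexHull {A : Finset (ℤ × ℤ)} {x : ℝ × ℝ}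
    (hx : x ∈ convexHull ℝ (toR2 '' (A : Set (ℤ × ℤ)))) (u : ℤ × ℤ) :
    u.1 * x.1 + u.2 * x.2 ≤ supportFn A u := by
  have hlin : IsLinearMap ℝ fun x : ℝ × ℝ ↦ (u.1 : ℝ) * x.1 + u.2 * x.2 :=
    ⟨fun x y ↦ by simp only [Prod.fst_add, Prod.snd_add]; ring,
      fun c x ↦ by simp only [Prod.smul_fst, Prod.smul_snd, smul_eq_mul]; ring⟩
  refine convexHull_min ?_ (convex_halfSpace_le hlin (supportFn A u : ℝ)) hx
  rintro _ ⟨p, hp, rfl⟩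
  have := dot_le_supportFn (Finset.mem_coe.1 hp) u
  simp only [toR2, Set.mem_ofPred_eq, dot] at *
  exact_mod_cast this

lemma dot_le_supportFn_of_mem_convexHull {A : Finset (ℤ × ℤ)} {p : ℤ × ℤ}
    (hp : toR2 p ∈ convexHull ℝ (toR2 '' (A : Set (ℤ × ℤ)))) (u : ℤ × ℤ) :
    dot u p ≤ supportFn A u := by
  have := le_supportFn_of_mem_convexHull hp u
  simp only [toR2, dot] at *
  exact_mod_cast this

lemma finite_latticePts_convexHull (A : Finset (ℤ × ℤ)) :
    (latticePts (convexHull ℝ (toR2 '' (A : Set (ℤ × ℤ))))).Finite := by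
  refine ((Finset.Icc (-supportFn A (-1, 0)) (supportFn A (1, 0)) ×ˢ
    Finset.Icc (-supportFn A (0, -1)) (supportFn A (0, 1))).finite_toSet).subset fun p hp ↦ ?_
  have h := dot_le_supportFn_of_mem_convexHull hp
  have h1 := h (1, 0)
  have h2 := h (-1, 0)
  have h3 := h (0, 1)
  have h4 := h (0, -1)
  simp only [dot] at h1 h2 h3 h4
  simp only [Finset.coe_product, Finset.coe_Icc, Set.mem_prod, Set.mem_Icc]
  omega

lemma isClosed_convexHull_toR2 (A : Finset (ℤ × ℤ)) :
    IsClosed (convexHull ℝ (toR2 '' (A : Set (ℤ × ℤ)))) :=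
  (A.finite_toSet.image toR2).isClosed_convexHull ℝ

/-- A point on a supporting line is not an interior point. -/
lemma notMem_interior_of_dot_eq {A : Finset (ℤ × ℤ)} {p w : ℤ × ℤ} (hw : w ≠ 0)
    (hp : dot w p = supportFn A w) :
    toR2 p ∉ interior (convexHull ℝ (toR2 '' (A : Set (ℤ × ℤ)))) := by
  intro hmem
  obtain ⟨t, ht, hpos⟩ := ((eventually_add_smul_mem_of_mem_interior hmem (toR2 w)).and
    self_mem_nhdsWithin).exists
  have hle := le_supportFn_of_mem_convexHull ht w
  rw [← hp] at hle
  simp only [toR2, dot, Prod.fst_add, Prod.snd_add, Prod.smul_fst, Prod.smul_snd,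
    smul_eq_mul] at hle
  push_cast at hle
  have hpos : 0 < t := hpos
  have hsq : (w.1 : ℝ) ^ 2 + (w.2 : ℝ) ^ 2 ≤ 0 := by
    by_contra! hlt
    nlinarith [mul_pos hpos hlt]
  have h1 : (w.1 : ℝ) = 0 := by nlinarith [sq_nonneg (w.1 : ℝ), sq_nonneg (w.2 : ℝ)]
  have h2 : (w.2 : ℝ) = 0 := by nlinarith [sq_nonneg (w.1 : ℝ), sq_nonneg (w.2 : ℝ)]
  exact hw (Prod.ext (by exact_mod_cast h1) (by exact_mod_cast h2))

section InteriorPoints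

variable {S I : Finset (ℤ × ℤ)}

lemma convexHull_subset_interior
    (hI : (I : Set (ℤ × ℤ)) = intPts (convexHull ℝ (toR2 '' (S : Set (ℤ × ℤ))))) :
    convexHull ℝ (toR2 '' (I : Set (ℤ × ℤ))) ⊆
      interior (convexHull ℝ (toR2 '' (S : Set (ℤ × ℤ)))) := by
  have hconv : Convex ℝ (interior (convexHull ℝ (toR2 '' (S : Set (ℤ × ℤ))))) :=
    (convex_convexHull ℝ _).interior
  refine convexHull_min ?_ hconv
  rintro _ ⟨p, hp, rfl⟩
  rwa [hI] at hp

lemma mem_of_smul_eq_combo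
    (hI : (I : Set (ℤ × ℤ)) = intPts (convexHull ℝ (toR2 '' (S : Set (ℤ × ℤ)))))
    {p q s z : ℤ × ℤ} (hp : p ∈ I) (hq : q ∈ I) (hs : s ∈ S) {a b c : ℤ} (ha : 0 ≤ a)
    (hb : 0 ≤ b) (hc : 0 ≤ c) (hab : 0 < a + b)
    (hz : (a + b + c) • z = a • p + b • q + c • s) : z ∈ I := by
  have hmem {x : ℤ × ℤ} :
      x ∈ I ↔ toR2 x ∈ interior (convexHull ℝ (toR2 '' (S : Set (ℤ × ℤ)))) := by
    rw [← Finset.mem_coe, hI]; rfl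
  have hconv := convex_convexHull ℝ (toR2 '' (S : Set (ℤ × ℤ)))
  have ha' : (0 : ℝ) ≤ a := by exact_mod_cast ha
  have hb' : (0 : ℝ) ≤ b := by exact_mod_cast hb
  have hc' : (0 : ℝ) ≤ c := by exact_mod_cast hc
  have hab' : (0 : ℝ) < a + b := by exact_mod_cast hab
  have hn : (0 : ℝ) < a + b + c := by linarith
  have hm := hconv.interior (hmem.1 hp) (hmem.1 hq) (a := (a : ℝ) / (a + b))
    (b := (b : ℝ) / (a + b)) (by positivity) (by positivity) (by field_simp)
  have := hconv.combo_interior_self_mem_interior hm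
    (subset_convexHull ℝ _ ⟨s, Finset.mem_coe.2 hs, rfl⟩) (a := ((a : ℝ) + b) / (a + b + c))
    (b := (c : ℝ) / (a + b + c)) (by positivity) (by positivity) (by field_simp)
  rw [hmem]
  convert this using 1
  have hz1 := congrArg (fun x : ℤ × ℤ ↦ (x.1 : ℝ)) hz
  have hz2 := congrArg (fun x : ℤ × ℤ ↦ (x.2 : ℝ)) hz
  simp only [Prod.fst_add, Prod.snd_add, Prod.smul_fst, Prod.smul_snd, smul_eq_mul] at hz1 hz2
  push_cast at hz1 hz2
  ext
  · simp only [toR2, Prod.fst_add, Prod.smul_fst, smul_eq_mul]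
    field_simp
    linarith
  · simp only [toR2, Prod.snd_add, Prod.smul_snd, smul_eq_mul]
    field_simp
    linarith

lemma exists_margin_of_eq_intPts
    (hI : (I : Set (ℤ × ℤ)) = intPts (convexHull ℝ (toR2 '' (S : Set (ℤ × ℤ))))) :
    ∃ ε : ℝ, 0 < ε ∧ ∀ p ∈ I, ∀ u : ℤ × ℤ,
      dot u p + ε * |(u.1 : ℝ)| ≤ supportFn S u ∧ dot u p + ε * |(u.2 : ℝ)| ≤ supportFn S u := by
  have hev (v : ℝ × ℝ) : ∀ᶠ t in nhdsWithin (0 : ℝ) (Set.Ioi 0), ∀ p ∈ I,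
      toR2 p + t • v ∈ convexHull ℝ (toR2 '' (S : Set (ℤ × ℤ))) := by
    refine (Filter.eventually_all_finset I).2 fun p hp ↦ ?_
    refine eventually_add_smul_mem_of_mem_interior ?_ v
    rw [← Finset.mem_coe, hI] at hp
    exact hp
  obtain ⟨ε, hε, h1, h2, h3, h4⟩ := (Filter.eventually_mem_set.2 self_mem_nhdsWithin |>.and <|
    (hev (1, 0)).and <| (hev (-1, 0)).and <| (hev (0, 1)).and (hev (0, -1))).exists
  refine ⟨ε, hε, fun p hp u ↦ ⟨?_, ?_⟩⟩
  · have := le_supportFn_of_mem_convexHull (h1 p hp) u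
    have := le_supportFn_of_mem_convexHull (h2 p hp) u
    simp only [toR2, dot, Prod.fst_add, Prod.snd_add, Prod.smul_fst, Prod.smul_snd,
      smul_eq_mul] at *
    push_cast
    rcases abs_choice (u.1 : ℝ) with h | h <;> rw [h] <;> linarith
  · have := le_supportFn_of_mem_convexHull (h3 p hp) u
    have := le_supportFn_of_mem_convexHull (h4 p hp) u
    simp only [toR2, dot, Prod.fst_add, Prod.snd_add, Prod.smul_fst, Prod.smul_snd,
      smul_eq_mul] at *
    push_cast
    rcases abs_choice (u.2 : ℝ) with h | h <;> rw [h] <;> linarith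

lemma exists_dot_ne_of_not_collinear (hI : ¬ Collinear ℝ (toR2 '' (I : Set (ℤ × ℤ))))
    {u : ℤ × ℤ} (hu : u ≠ 0) : ∃ p ∈ I, ∃ q ∈ I, dot u p ≠ dot u q := by
  by_contra! hall
  rcases I.eq_empty_or_nonempty with rfl | ⟨p₀, hp₀⟩
  · exact hI (by simpa using collinear_empty ℝ (ℝ × ℝ))
  refine hI ((collinear_iff_of_mem (Set.mem_image_of_mem toR2 (Finset.mem_coe.2 hp₀))).2
    ⟨(-(u.2 : ℝ), (u.1 : ℝ)), ?_⟩)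
  rintro _ ⟨p, hp, rfl⟩
  have hd := hall p hp p₀ hp₀
  have hsq : (u.1 : ℝ) ^ 2 + (u.2 : ℝ) ^ 2 ≠ 0 := by
    intro h0
    have h1 : (u.1 : ℝ) = 0 := by nlinarith [sq_nonneg (u.1 : ℝ), sq_nonneg (u.2 : ℝ)]
    have h2 : (u.2 : ℝ) = 0 := by nlinarith [sq_nonneg (u.1 : ℝ), sq_nonneg (u.2 : ℝ)]
    exact hu (Prod.ext (by exact_mod_cast h1) (by exact_mod_cast h2))
  have hd' : (u.1 : ℝ) * p.1 + u.2 * p.2 = u.1 * p₀.1 + u.2 * p₀.2 := by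
    simp only [dot] at hd
    exact_mod_cast hd
  refine ⟨(u.1 * (p.2 - p₀.2) - u.2 * (p.1 - p₀.1)) / ((u.1 : ℝ) ^ 2 + (u.2 : ℝ) ^ 2), ?_⟩
  ext
  · simp only [toR2, vadd_eq_add, Prod.fst_add, Prod.smul_fst, smul_eq_mul]
    field_simp
    linear_combination (u.1 : ℝ) * hd'
  · simp only [toR2, vadd_eq_add, Prod.snd_add, Prod.smul_snd, smul_eq_mul]
    field_simp
    linear_combination (u.2 : ℝ) * hd'

lemma exists_separating_of_notMem {y : ℤ × ℤ}
    (hy : toR2 y ∉ convexHull ℝ (toR2 '' (I : Set (ℤ × ℤ)))) : ∃ f : ℝ × ℝ, ∀ p ∈ I,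
    f.1 * p.1 + f.2 * p.2 < f.1 * y.1 + f.2 * y.2 := by
  obtain ⟨f, c, hf, hc⟩ := geometric_hahn_banach_closed_point (convex_convexHull ℝ _)
    (isClosed_convexHull_toR2 I) hy
  have happly (p : ℤ × ℤ) : f (toR2 p) = f (1, 0) * p.1 + f (0, 1) * p.2 := by
    have : toR2 p = (p.1 : ℝ) • ((1, 0) : ℝ × ℝ) + (p.2 : ℝ) • ((0, 1) : ℝ × ℝ) := by
      simp [toR2]
    rw [this, map_add, map_smul, map_smul, smul_eq_mul, smul_eq_mul]
    ring
  refine ⟨(f (1, 0), f (0, 1)), fun p hp ↦ ?_⟩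
  have h1 := hf _ (subset_convexHull ℝ _ ⟨p, Finset.mem_coe.2 hp, rfl⟩)
  simp only [← happly]
  linarith

/-- The vertices of a nonhyperelliptic polygon and its interior lattice points. -/
lemma isInteriorPair_of_eq_intPts
    (hI : (I : Set (ℤ × ℤ)) = intPts (convexHull ℝ (toR2 '' (S : Set (ℤ × ℤ)))))
    (hcol : ¬ Collinear ℝ (toR2 '' (I : Set (ℤ × ℤ)))) : IsInteriorPair S I where
  outer_nonempty := by
    rw [Finset.nonempty_iff_ne_empty]
    rintro rfl
    have : I = ∅ := by simpa [intPts] using hI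
    exact hcol (by simpa [this] using collinear_empty ℝ (ℝ × ℝ))
  inner_nonempty := by
    rw [Finset.nonempty_iff_ne_empty]
    rintro rfl
    exact hcol (by simpa using collinear_empty ℝ (ℝ × ℝ))
  combo_mem _ hp _ hq _ hs _ _ _ _ ha hb hc hab hz :=
    mem_of_smul_eq_combo hI hp hq hs ha hb hc hab hz
  exists_margin := exists_margin_of_eq_intPts hI
  exists_dot_ne _ hu := exists_dot_ne_of_not_collinear hcol hu
  exists_separating y hy := exists_separating_of_notMem fun hmem ↦
    hy (by rw [← Finset.mem_coe, hI]; exact convexHull_subset_interior hI hmem)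

end InteriorPoints

/-- for a 2-dimensional maximal nonhyperelliptic lattice polytope
`Δ ⊂ ℝ²` one has `r ≤ r⁽¹⁾ + 9`. -/
theorem boundary_points_le (Δ : Set (ℝ × ℝ))
    (hlat : IsLatticePolytope Δ) (hdim : ¬ Collinear ℝ Δ)
    (hmax : IsMaximalPolytope Δ) (hnh : ¬ IsHyperelliptic Δ) :
    (bdPts Δ).ncard ≤ (bdPts (interiorHull Δ)).ncard + 9 := by
  obtain ⟨S, rfl⟩ := hlat
  have hfin : (intPts (convexHull ℝ (toR2 '' (S : Set (ℤ × ℤ))))).Finite :=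
    (finite_latticePts_convexHull S).subset fun p hp ↦
      interior_subset (s := convexHull ℝ (toR2 '' (S : Set (ℤ × ℤ)))) hp
  obtain ⟨I, hI⟩ := hfin.exists_finset_coe
  rw [IsHyperelliptic, ← hI] at hnh
  rw [interiorHull, ← hI]
  obtain ⟨B, C, hB, hC, hcard⟩ := (isInteriorPair_of_eq_intPts hI hnh).exists_card_le
  have hle : (bdPts (convexHull ℝ (toR2 '' (S : Set (ℤ × ℤ))))).ncard ≤ B.card := by
    rw [← Set.ncard_coe_finset]
    refine Set.ncard_le_ncard (fun y hy ↦ ?_) B.finite_toSet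
    rw [bdPts, Set.mem_ofPred_eq, (isClosed_convexHull_toR2 S).frontier_eq] at hy
    refine hB y (fun hyI ↦ hy.2 ?_) (dot_le_supportFn_of_mem_convexHull hy.1)
    rw [← Finset.mem_coe, hI] at hyI
    exact hyI
  have hge : C.card ≤ (bdPts (convexHull ℝ (toR2 '' (I : Set (ℤ × ℤ))))).ncard := by
    rw [← Set.ncard_coe_finset]
    refine Set.ncard_le_ncard (fun y hy ↦ ?_) ((finite_latticePts_convexHull I).subset fun y hy ↦
      (isClosed_convexHull_toR2 I).frontier_subset hy)
    obtain ⟨hyI, w, hw, hwy⟩ := hC y hy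
    rw [bdPts, Set.mem_ofPred_eq, (isClosed_convexHull_toR2 I).frontier_eq]
    exact ⟨subset_convexHull ℝ _ ⟨y, hyI, rfl⟩, notMem_interior_of_dot_eq hw hwy⟩
  omega
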